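/- Let G^c : ℂ^d × ℝ^d → ℂ be a kernel which is Borel measurable in the second argument, holomorphic in the first argument, such that for every compact K ⊆ ℂ^d the envelope g_K(x) = sup_{z∈K} |G^c(z, x)| is measurable, and which is invariant under real translations: G^c(z + ã, x + a) = G^c(z, x) for all a ∈ ℝ^d, z ∈ ℂ^d, x ∈ ℝ^d, where ã ∈ ℂ^d denotes a with coordinates regarded as complex numbers. Let μ be a probability measure on the space of measures on ℝ^d (with the σ-algebra generated by the evaluation maps) such that ∫ exp(∫ g_K dη) dμ(η) < ∞ for every compact K ⊆ ℂ^d, and such that μ is translation invariant: for every a ∈ ℝ^d the pushforward of μ under the map η ↦ (pushforward of η under x ↦ x + a) equals μ. Then for every n the function S_n^c(z₁, …, z_n) = ∫ ∏_{j=1}^n (∫ G^c(z_j, x) dη(x)) dμ(η) satisfies S_n^c(z₁ + w, …, z_n + w) = S_n^c(z₁, …, z_n) for all complex translations w ∈ ℂ^d. (This is Theorem 6.3 in the case of the translation group: Euclidean translation invariance extends to the complexified translation group, hence to relativistic time translations.) -/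

import Mathlib

open MeasureTheory

/-- The compact envelope `g_K(x) = sup_{z ∈ K} |G(z, x)|` of a kernel. -/
noncomputable def envelope {d : ℕ} {S : Type*}
    (G : (Fin d → ℂ) → S → ℂ) (K : Set (Fin d → ℂ)) (x : S) : ℝ :=
  sSup ((fun z => ‖G z x‖) '' K)

/-- The exponential on `[0, ∞]` with the convention `exp(∞) = ∞`. -/
noncomputable def expE (a : ENNReal) : ENNReal :=
  if a = ⊤ then ⊤ else ENNReal.ofReal (Real.exp a.toReal)

open Metric Set Filter Topology

/-- An integral of functions that are almost surely entire in a complex parameter, dominated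
locally uniformly in the parameter, is entire. -/
theorem differentiable_integral_of_locally_dominated {α : Type*} [MeasurableSpace α]
    {μ : Measure α} {h : ℂ → α → ℂ} (hmeas : ∀ t, AEStronglyMeasurable (h t) μ)
    (hdiff : ∀ᵐ a ∂μ, Differentiable ℂ (fun t => h t a))
    (hbound : ∀ R : ℝ, ∃ b : α → ℝ, Integrable b μ ∧ ∀ᵐ a ∂μ, ∀ t, ‖t‖ ≤ R → ‖h t a‖ ≤ b a) :
    Differentiable ℂ (fun t => ∫ a, h t a ∂μ) := by
  intro t₀
  obtain ⟨b, hb, hle⟩ := hbound (‖t₀‖ + 2)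
  have hnorm : ∀ t ∈ ball t₀ 1, ∀ s ∈ closedBall t 1, ‖s‖ ≤ ‖t₀‖ + 2 := by
    intro t ht s hs
    rw [mem_ball, dist_eq_norm] at ht
    rw [mem_closedBall, dist_eq_norm] at hs
    calc ‖s‖ = ‖t₀ + (t - t₀) + (s - t)‖ := by congr 1; ring
      _ ≤ ‖t₀‖ + ‖t - t₀‖ + ‖s - t‖ := norm_add₃_le
      _ ≤ ‖t₀‖ + 2 := by linarith
  refine (hasDerivAt_integral_of_dominated_loc_of_deriv_le (F := h)
    (F' := fun t a => deriv (fun s => h s a) t) (bound := b)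
    (ball_mem_nhds t₀ one_pos) (Eventually.of_forall hmeas) ?_ ?_ ?_ hb ?_).2.differentiableAt
  · refine hb.mono' (hmeas t₀) ?_
    filter_upwards [hle] with a ha using ha t₀ (by linarith)
  · refine aestronglyMeasurable_of_tendsto_ae (𝓝[≠] (0 : ℂ))
      (f := fun ε a => ε⁻¹ • (h (t₀ + ε) a - h t₀ a))
      (fun ε => ((hmeas (t₀ + ε)).sub (hmeas t₀)).const_smul ε⁻¹) ?_
    filter_upwards [hdiff] with a ha
    have hslope := hasDerivAt_iff_tendsto_slope_zero.1 (ha t₀).hasDerivAt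
    exact hslope
  · filter_upwards [hdiff, hle] with a ha hla t ht
    simpa using Complex.norm_deriv_le_of_forall_mem_sphere_norm_le one_pos ha.diffContOnCl
      (fun s hs => hla s (hnorm t ht s (sphere_subset_closedBall hs)))
  · filter_upwards [hdiff] with a ha t _ using (ha t).hasDerivAt

theorem measurable_expE : Measurable expE := by
  unfold expE
  exact Measurable.ite (measurableSet_singleton _) measurable_const
    (Real.measurable_exp.comp ENNReal.measurable_toReal).ennreal_ofReal

theorem ofReal_pow_le_factorial_mul_expE (a : ENNReal) (n : ℕ) :
    ENNReal.ofReal (a.toReal ^ n) ≤ (n.factorial : ENNReal) * expE a := by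
  unfold expE
  split_ifs with h
  · rw [ENNReal.mul_top (by exact_mod_cast n.factorial_ne_zero)]
    exact le_top
  · rw [← ENNReal.ofReal_natCast, ← ENNReal.ofReal_mul (by positivity)]
    refine ENNReal.ofReal_le_ofReal ?_
    have := Real.pow_div_factorial_le_exp _ (ENNReal.toReal_nonneg (a := a)) n
    rwa [div_le_iff₀' (by positivity)] at this

/-- Under a random measure for which `f` is almost surely integrable, `η ↦ ∫ f dη` is almost
everywhere measurable. -/
theorem aestronglyMeasurable_integral_measure {α : Type*} [MeasurableSpace α]
    {μ : Measure (Measure α)} {f : α → ℂ} (hf : Measurable f)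
    (hint : ∀ᵐ η ∂μ, Integrable f η) :
    AEStronglyMeasurable (fun η : Measure α => ∫ x, f x ∂η) μ := by
  have key : ∀ g : α → ℝ, Measurable g → Measurable (fun η : Measure α =>
      ENNReal.toReal (∫⁻ a, .ofReal (g a) ∂η) - ENNReal.toReal (∫⁻ a, .ofReal (-g a) ∂η)) :=
    fun g hg => (Measure.measurable_lintegral hg.ennreal_ofReal).ennreal_toReal.sub
      (Measure.measurable_lintegral hg.neg.ennreal_ofReal).ennreal_toReal
  have hre := key _ (Complex.measurable_re.comp hf)
  have him := key _ (Complex.measurable_im.comp hf)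
  refine AEMeasurable.aestronglyMeasurable
    ⟨_, (Complex.measurable_ofReal.comp hre).add
      ((Complex.measurable_ofReal.comp him).mul_const Complex.I), ?_⟩
  filter_upwards [hint] with η hη
  simp only [Pi.add_apply, Function.comp_apply]
  rw [← integral_re_add_im hη,
    integral_eq_lintegral_pos_part_sub_lintegral_neg_part hη.re,
    integral_eq_lintegral_pos_part_sub_lintegral_neg_part hη.im]
  rfl

theorem envelope_nonneg {d : ℕ} {S : Type*} (G : (Fin d → ℂ) → S → ℂ) (K : Set (Fin d → ℂ))
    (x : S) : 0 ≤ envelope G K x :=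
  Real.sSup_nonneg (by rintro _ ⟨z, -, rfl⟩; exact norm_nonneg _)

theorem norm_le_envelope {d : ℕ} {S : Type*} {G : (Fin d → ℂ) → S → ℂ} {K : Set (Fin d → ℂ)}
    (hK : IsCompact K) {x : S} (hG : Continuous (fun z => G z x)) {z : Fin d → ℂ} (hz : z ∈ K) :
    ‖G z x‖ ≤ envelope G K x :=
  le_csSup (hK.image hG.norm).bddAbove (mem_image_of_mem _ hz)

theorem eq_of_differentiable_of_eq_ofReal {f : ℂ → ℂ} (hf : Differentiable ℂ f) {c : ℂ}
    (h : ∀ t : ℝ, f t = c) (z : ℂ) : f z = c := by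
  have ha : AnalyticOnNhd ℂ f univ := hf.differentiableOn.analyticOnNhd isOpen_univ
  have ht : Tendsto (fun t : ℝ => (t : ℂ)) (𝓝[≠] 0) (𝓝[≠] 0) := by
    refine tendsto_nhdsWithin_iff.2 ⟨?_, ?_⟩
    · exact (Complex.continuous_ofReal.tendsto' 0 0 (by simp)).mono_left nhdsWithin_le_nhds
    · filter_upwards [self_mem_nhdsWithin] with t ht
      simpa using ht
  exact congrFun (ha.eq_of_frequently_eq (z₀ := 0) (g := fun _ => c) (analyticOnNhd_const)
    (ht.frequently (Eventually.frequently (Eventually.of_forall h)))) z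

section Schwinger

variable {d : ℕ} {G : (Fin d → ℂ) → (Fin d → ℝ) → ℂ} {μ : Measure (Measure (Fin d → ℝ))}

theorem ae_integrable_envelope
    (henv : ∀ K : Set (Fin d → ℂ), IsCompact K → Measurable (envelope G K))
    (hexp : ∀ K : Set (Fin d → ℂ), IsCompact K →
      ∫⁻ η, expE (∫⁻ x, ENNReal.ofReal (envelope G K x) ∂η) ∂μ < ⊤)
    {K : Set (Fin d → ℂ)} (hK : IsCompact K) :
    ∀ᵐ η ∂μ, Integrable (envelope G K) η := by
  have hm := Measure.measurable_lintegral (henv K hK).ennreal_ofReal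
  filter_upwards [ae_lt_top (measurable_expE.comp hm) (hexp K hK).ne] with η hη
  refine ⟨(henv K hK).aestronglyMeasurable, ?_⟩
  rw [hasFiniteIntegral_iff_ofReal (Eventually.of_forall (envelope_nonneg G K))]
  by_contra! htop
  simp [expE, top_le_iff.1 htop] at hη

theorem integrable_pow_integral_envelope
    (henv : ∀ K : Set (Fin d → ℂ), IsCompact K → Measurable (envelope G K))
    (hexp : ∀ K : Set (Fin d → ℂ), IsCompact K →
      ∫⁻ η, expE (∫⁻ x, ENNReal.ofReal (envelope G K x) ∂η) ∂μ < ⊤)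
    {K : Set (Fin d → ℂ)} (hK : IsCompact K) (n : ℕ) :
    Integrable (fun η : Measure (Fin d → ℝ) => (∫ x, envelope G K x ∂η) ^ n) μ := by
  have hm := Measure.measurable_lintegral (henv K hK).ennreal_ofReal
  have heq : (fun η : Measure (Fin d → ℝ) => (∫ x, envelope G K x ∂η) ^ n) =
      fun η => (∫⁻ x, ENNReal.ofReal (envelope G K x) ∂η).toReal ^ n := by
    funext η
    rw [integral_eq_lintegral_of_nonneg_ae (Eventually.of_forall (envelope_nonneg G K))
      (henv K hK).aestronglyMeasurable]
  rw [heq]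
  refine ⟨(hm.ennreal_toReal.pow_const n).aestronglyMeasurable, ?_⟩
  rw [hasFiniteIntegral_iff_ofReal (Eventually.of_forall fun η => by positivity)]
  calc _ ≤ ∫⁻ η, (n.factorial : ENNReal) *
        expE (∫⁻ x, ENNReal.ofReal (envelope G K x) ∂η) ∂μ :=
        lintegral_mono fun η => ofReal_pow_le_factorial_mul_expE _ n
    _ < ⊤ := by
        rw [lintegral_const_mul' _ _ (ENNReal.natCast_ne_top _)]
        exact ENNReal.mul_lt_top (ENNReal.natCast_lt_top _) (hexp K hK)

theorem ae_integrable_kernel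
    (hmeas : ∀ z, Measurable (fun x => G z x))
    (hholo : ∀ x, Differentiable ℂ (fun z => G z x))
    (henv : ∀ K : Set (Fin d → ℂ), IsCompact K → Measurable (envelope G K))
    (hexp : ∀ K : Set (Fin d → ℂ), IsCompact K →
      ∫⁻ η, expE (∫⁻ x, ENNReal.ofReal (envelope G K x) ∂η) ∂μ < ⊤)
    (z : Fin d → ℂ) : ∀ᵐ η ∂μ, Integrable (fun x => G z x) η := by
  filter_upwards [ae_integrable_envelope henv hexp (isCompact_singleton (x := z))] with η hη
  exact hη.mono' (hmeas z).aestronglyMeasurable (Eventually.of_forall fun x =>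
    norm_le_envelope isCompact_singleton (hholo x).continuous rfl)

theorem aestronglyMeasurable_prod_integral
    (hmeas : ∀ z, Measurable (fun x => G z x))
    (hholo : ∀ x, Differentiable ℂ (fun z => G z x))
    (henv : ∀ K : Set (Fin d → ℂ), IsCompact K → Measurable (envelope G K))
    (hexp : ∀ K : Set (Fin d → ℂ), IsCompact K →
      ∫⁻ η, expE (∫⁻ x, ENNReal.ofReal (envelope G K x) ∂η) ∂μ < ⊤)
    {n : ℕ} (z : Fin n → (Fin d → ℂ)) :
    AEStronglyMeasurable (fun η : Measure (Fin d → ℝ) => ∏ j, ∫ x, G (z j) x ∂η) μ :=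
  Finset.aestronglyMeasurable_fun_prod _ fun _ _ =>
    aestronglyMeasurable_integral_measure (hmeas _)
      (ae_integrable_kernel hmeas hholo henv hexp _)

/-- The Schwinger functions are entire along every complex line of simultaneous translations. -/
theorem differentiable_schwinger_line
    (hmeas : ∀ z, Measurable (fun x => G z x))
    (hholo : ∀ x, Differentiable ℂ (fun z => G z x))
    (henv : ∀ K : Set (Fin d → ℂ), IsCompact K → Measurable (envelope G K))
    (hexp : ∀ K : Set (Fin d → ℂ), IsCompact K →
      ∫⁻ η, expE (∫⁻ x, ENNReal.ofReal (envelope G K x) ∂η) ∂μ < ⊤)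
    {n : ℕ} (z : Fin n → (Fin d → ℂ)) (v : Fin d → ℂ) :
    Differentiable ℂ (fun t : ℂ => ∫ η, ∏ j, ∫ x, G (z j + t • v) x ∂η ∂μ) := by
  let K : ℝ → Set (Fin d → ℂ) := fun R => ⋃ j, (fun t : ℂ => z j + t • v) '' closedBall 0 R
  have hK : ∀ R, IsCompact (K R) := fun R =>
    isCompact_iUnion fun j => (isCompact_closedBall 0 R).image (by fun_prop)
  have hmem : ∀ {R : ℝ} (j : Fin n) {t : ℂ}, ‖t‖ ≤ R → z j + t • v ∈ K R := fun j t ht =>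
    mem_iUnion.2 ⟨j, t, by simpa using ht, rfl⟩
  have hle : ∀ {R : ℝ} (j : Fin n) {t : ℂ}, ‖t‖ ≤ R → ∀ x,
      ‖G (z j + t • v) x‖ ≤ envelope G (K R) x := fun j t ht x =>
    norm_le_envelope (hK _) (hholo x).continuous (hmem j ht)
  refine differentiable_integral_of_locally_dominated
    (fun t => aestronglyMeasurable_prod_integral hmeas hholo henv hexp _) ?_ fun R =>
    ⟨fun η => (∫ x, envelope G (K R) x ∂η) ^ n,
      integrable_pow_integral_envelope henv hexp (hK R) n, ?_⟩
  · have hall : ∀ᵐ η ∂μ, ∀ N : ℕ, Integrable (envelope G (K N)) η :=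
      ae_all_iff.2 fun N => ae_integrable_envelope henv hexp (hK N)
    filter_upwards [hall] with η hη
    refine Differentiable.fun_finsetProd fun j _ =>
      differentiable_integral_of_locally_dominated (fun t => (hmeas _).aestronglyMeasurable)
        (Eventually.of_forall fun x => (hholo x).comp (by fun_prop)) fun R => ?_
    obtain ⟨N, hN⟩ := exists_nat_ge R
    exact ⟨envelope G (K N), hη N,
      Eventually.of_forall fun x t ht => hle j (ht.trans hN) x⟩
  · filter_upwards [ae_integrable_envelope henv hexp (hK R)] with η hη t ht
    calc ‖∏ j, ∫ x, G (z j + t • v) x ∂η‖ = ∏ j, ‖∫ x, G (z j + t • v) x ∂η‖ := norm_prod _ _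
      _ ≤ ∏ _j : Fin n, ∫ x, envelope G (K R) x ∂η :=
          Finset.prod_le_prod (fun _ _ => norm_nonneg _) fun j _ =>
            norm_integral_le_of_norm_le hη (Eventually.of_forall (hle j ht))
      _ = _ := by simp

theorem schwinger_real_translation_invariance
    (hmeas : ∀ z, Measurable (fun x => G z x))
    (hholo : ∀ x, Differentiable ℂ (fun z => G z x))
    (henv : ∀ K : Set (Fin d → ℂ), IsCompact K → Measurable (envelope G K))
    (hGinv : ∀ (a : Fin d → ℝ) (z : Fin d → ℂ) (x : Fin d → ℝ),
      G (z + fun i => (a i : ℂ)) (x + a) = G z x)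
    (hexp : ∀ K : Set (Fin d → ℂ), IsCompact K →
      ∫⁻ η, expE (∫⁻ x, ENNReal.ofReal (envelope G K x) ∂η) ∂μ < ⊤)
    (htrans : ∀ a : Fin d → ℝ,
      μ.map (fun η : Measure (Fin d → ℝ) => η.map (fun x => x + a)) = μ)
    {n : ℕ} (z : Fin n → (Fin d → ℂ)) (a : Fin d → ℝ) :
    ∫ η, ∏ j, ∫ x, G (z j + fun i => (a i : ℂ)) x ∂η ∂μ = ∫ η, ∏ j, ∫ x, G (z j) x ∂η ∂μ := by
  have hmap : Measurable (fun η : Measure (Fin d → ℝ) => η.map (fun x => x + a)) :=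
    Measure.measurable_map _ (measurable_add_const a)
  have hF := aestronglyMeasurable_prod_integral (μ := μ) hmeas hholo henv hexp
    (fun j => z j + fun i => (a i : ℂ))
  calc _ = ∫ η, ∏ j, ∫ x, G (z j + fun i => (a i : ℂ)) x ∂η
        ∂(μ.map (fun η : Measure (Fin d → ℝ) => η.map (fun x => x + a))) := by rw [htrans]
    _ = _ := by
      rw [integral_map hmap.aemeasurable (by rwa [htrans])]
      refine integral_congr_ae (Eventually.of_forall fun η => Finset.prod_congr rfl fun j _ => ?_)
      rw [integral_map (measurable_add_const a).aemeasurable (hmeas _).aestronglyMeasurable]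
      simp only [hGinv]

end Schwinger

/-- Theorem 6.3 for the translation group: if the kernel is invariant under real
translations and the random measure `μ` is translation invariant, then the
analytically continued Schwinger functions are invariant under all complex
translations. -/
theorem schwinger_complex_translation_invariance {d : ℕ}
    (G : (Fin d → ℂ) → (Fin d → ℝ) → ℂ)
    (hmeas : ∀ z, Measurable (fun x => G z x))
    (hholo : ∀ x, Differentiable ℂ (fun z => G z x))
    (henv : ∀ K : Set (Fin d → ℂ), IsCompact K → Measurable (envelope G K))
    (hGinv : ∀ (a : Fin d → ℝ) (z : Fin d → ℂ) (x : Fin d → ℝ),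
      G (z + fun i => (a i : ℂ)) (x + a) = G z x)
    (μ : Measure (Measure (Fin d → ℝ))) [IsProbabilityMeasure μ]
    (hexp : ∀ K : Set (Fin d → ℂ), IsCompact K →
      ∫⁻ η, expE (∫⁻ x, ENNReal.ofReal (envelope G K x) ∂η) ∂μ < ⊤)
    (htrans : ∀ a : Fin d → ℝ,
      μ.map (fun η : Measure (Fin d → ℝ) => η.map (fun x => x + a)) = μ)
    (n : ℕ) (w : Fin d → ℂ) (z : Fin n → (Fin d → ℂ)) :
    ∫ η, ∏ j, ∫ x, G (z j + w) x ∂η ∂μ = ∫ η, ∏ j, ∫ x, G (z j) x ∂η ∂μ := by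
  have hreal := fun {n : ℕ} (z : Fin n → (Fin d → ℂ)) (a : Fin d → ℝ) =>
    schwinger_real_translation_invariance hmeas hholo henv hGinv hexp htrans z a
  let v : Fin d → ℂ := fun i => ((w i).im : ℂ)
  have hconst := eq_of_differentiable_of_eq_ofReal
    (differentiable_schwinger_line hmeas hholo henv hexp z v)
    (c := ∫ η, ∏ j, ∫ x, G (z j) x ∂η ∂μ) (fun t => by
      have hv : (t : ℂ) • v = fun i => (((t * (w i).im : ℝ)) : ℂ) := by
        funext i
        simp [v]
      rw [hv]
      exact hreal z _) Complex.I
  have hw : ∀ j, z j + w = (z j + Complex.I • v) + fun i => ((w i).re : ℂ) := fun j => by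
    funext i
    simp only [v, Pi.add_apply, Pi.smul_apply, smul_eq_mul]
    conv_lhs => rw [← Complex.re_add_im (w i)]
    ring
  simp_rw [hw]
  exact (hreal (fun j => z j + Complex.I • v) _).trans hconst
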